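/- Let M = M^0(S; F(I), G(Lambda); P) be a Rees matrix semigroup with zero over a semigroupoid S. Suppose M is an automatic semigroup, and the set of non-identity arrows of S is weakly right-ideal-generated by a row cross-section of P. Then S is automatic. -/

import Mathlib

/- Common framework: graphs, path languages, synchronous regularity,
   semigroupoids, automatic structures, and Rees matrix constructions. -/

namespace AutoRees

/-- Raw data of a semigroupoid: source and target maps on arrows together with a
totalised multiplication (whose values are only meaningful on composable pairs). -/
structure PreSgpd (O A : Type) where
  src : A → O
  tgt : A → O
  mul : A → A → A

/-- A semigroupoid: the multiplication respects sources and targets and is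
associative, on composable pairs. -/
structure Sgpd (O A : Type) extends PreSgpd O A where
  src_mul : ∀ e f, tgt e = src f → src (mul e f) = src e
  tgt_mul : ∀ e f, tgt e = src f → tgt (mul e f) = tgt f
  mul_assoc' : ∀ e f g, tgt e = src f → tgt f = src g →
    mul (mul e f) g = mul e (mul f g)

/-- Evaluate a nonempty word of edge labels as a product in the semigroupoid
(`none` on the empty word). -/
def evalPath? {O A E : Type} (S : PreSgpd O A) (lab : E → A) : List E → Option A
  | [] => none
  | e :: l => some ((l.map lab).foldl S.mul (lab e))

/-- The consecutive-compatibility condition making a list of edges a path. -/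
def IsPathChain {V E : Type} (esrc etgt : E → V) (l : List E) : Prop :=
  List.Chain' (fun e f => etgt e = esrc f) l

/-- The target of a non-empty path. -/
def pathTgt? {V E : Type} (etgt : E → V) (l : List E) : Option V :=
  l.getLast?.map etgt

/-- The source of a non-empty path. -/
def pathSrc? {V E : Type} (esrc : E → V) (l : List E) : Option V :=
  l.head?.map esrc

/-- A set of words is regular if it is a regular language in the usual sense. -/
def IsRegularSet {α : Type} (L : Set (List α)) : Prop :=
  Language.IsRegular (show Language α from L)

/-- The padding symbol used to pad a pair of paths, at the target of `l`
(the letters of the padded alphabet `X^$` are `Sum.inl` (a genuine edge) or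
`Sum.inr (some v)` (the padding edge at vertex `v`)). -/
def padSym {V E : Type} (etgt : E → V) (l : List E) : E ⊕ Option V :=
  Sum.inr (l.getLast?.map etgt)

/-- The padded convolution `(a, b) δ_X` of a pair of paths. -/
def deltaPair {V E : Type} (etgt : E → V) (a b : List E) :
    List ((E ⊕ Option V) × (E ⊕ Option V)) :=
  (a.map Sum.inl).zip (b.map Sum.inl) ++
    (if a.length ≤ b.length
      then (b.drop a.length).map (fun e => (padSym etgt a, Sum.inl e))
      else (a.drop b.length).map (fun e => (Sum.inl e, padSym etgt b)))

/-- A binary relation on paths is synchronously regular if its image under the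
padding map is a regular language over the padded product alphabet. -/
def SyncRegular {V E : Type} (etgt : E → V) (R : Set (List E × List E)) : Prop :=
  IsRegularSet { w | ∃ p ∈ R, w = deltaPair etgt p.1 p.2 }

/-- A choice of representatives `(X, K, ρ)` for a semigroupoid `S`: a graph `X`
with vertex set `S^0` (edge set `E`, source `esrc`, target `etgt`), a semigroupoid
morphism `ρ : X^+ → S` (induced by the edge-labelling `lab`), and a language `K`
of non-empty paths with `K ρ = S^1`. -/
structure ChoiceOfReps {O A : Type} (S : PreSgpd O A) (E : Type) where
  esrc : E → O
  etgt : E → O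
  lab : E → A
  lab_src : ∀ e, S.src (lab e) = esrc e
  lab_tgt : ∀ e, S.tgt (lab e) = etgt e
  K : Set (List E)
  K_path : ∀ l ∈ K, l ≠ [] ∧ IsPathChain esrc etgt l
  K_onto : ∀ a : A, ∃ l ∈ K, evalPath? S lab l = some a

variable {O A E : Type} {S : PreSgpd O A}

/-- The relation `K_=` = {(u,v) ∈ K × K : u ρ = v ρ}. -/
def relEq (C : ChoiceOfReps S E) : Set (List E × List E) :=
  { p | p.1 ∈ C.K ∧ p.2 ∈ C.K ∧ evalPath? S C.lab p.1 = evalPath? S C.lab p.2 }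

/-- The relation `K_a` for an edge `a` of `X`. -/
def relEdge (C : ChoiceOfReps S E) (a : E) : Set (List E × List E) :=
  { p | p.1 ∈ C.K ∧ p.2 ∈ C.K ∧ pathTgt? C.etgt p.1 = some (C.esrc a) ∧
        evalPath? S C.lab (p.1 ++ [a]) = evalPath? S C.lab p.2 }

/-- The relation `K_a` for a vertex `a` of `X` (regarded as the empty path at `a`). -/
def relVertex (C : ChoiceOfReps S E) (v : O) : Set (List E × List E) :=
  { p | p.1 ∈ C.K ∧ p.2 ∈ C.K ∧ pathTgt? C.etgt p.1 = some v ∧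
        evalPath? S C.lab p.1 = evalPath? S C.lab p.2 }

/-- An automatic structure: a finitely generated choice of representatives with
`K` regular such that `K_a` is synchronously regular for every edge and vertex. -/
def IsAutomaticStructure (C : ChoiceOfReps S E) : Prop :=
  Finite E ∧ IsRegularSet C.K ∧
    (∀ a : E, SyncRegular C.etgt (relEdge C a)) ∧
    (∀ v : O, SyncRegular C.etgt (relVertex C v))

/-- The set of non-empty prefixes of words in `K`. -/
def prefs {E : Type} (K : Set (List E)) : Set (List E) :=
  { p | p ≠ [] ∧ ∃ l ∈ K, p <+: l }

/-- The relation `K'_=` = {(u,v) ∈ K × Pref(K) : u ρ = v ρ}. -/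
def relPrefEq (C : ChoiceOfReps S E) : Set (List E × List E) :=
  { p | p.1 ∈ C.K ∧ p.2 ∈ prefs C.K ∧ evalPath? S C.lab p.1 = evalPath? S C.lab p.2 }

/-- A prefix-automatic structure. -/
def IsPrefixAutomaticStructure (C : ChoiceOfReps S E) : Prop :=
  IsAutomaticStructure C ∧ SyncRegular C.etgt (relPrefEq C)

/-- A cross-section: `ρ` restricted to `K` is injective. -/
def IsCrossSection (C : ChoiceOfReps S E) : Prop :=
  ∀ u ∈ C.K, ∀ v ∈ C.K, evalPath? S C.lab u = evalPath? S C.lab v → u = v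

/-- `K` is closed under taking non-empty prefixes. -/
def IsPrefixClosed (C : ChoiceOfReps S E) : Prop :=
  ∀ l ∈ C.K, ∀ p : List E, p ≠ [] → p <+: l → p ∈ C.K

/-- A semigroupoid (or semigroup, in the one-object case) is automatic if it
admits an automatic structure. -/
def IsAutomatic (S : PreSgpd O A) : Prop :=
  ∃ (E : Type) (C : ChoiceOfReps S E), IsAutomaticStructure C

/-- Prefix-automaticity. -/
def IsPrefixAutomatic (S : PreSgpd O A) : Prop :=
  ∃ (E : Type) (C : ChoiceOfReps S E), IsPrefixAutomaticStructure C

/-- Finite generation: every arrow is a (composable) product of arrows from some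
fixed finite set. -/
def IsFG (S : PreSgpd O A) : Prop :=
  ∃ T : Set A, T.Finite ∧ ∀ a : A, ∃ l : List A, l ≠ [] ∧ (∀ x ∈ l, x ∈ T) ∧
    IsPathChain S.src S.tgt l ∧ evalPath? S id l = some a

/-- An arrow is an identity if it acts as an identity on all composable products. -/
def IsIdentity (S : PreSgpd O A) (e : A) : Prop :=
  (∀ x, S.tgt e = S.src x → S.mul e x = x) ∧ (∀ y, S.tgt y = S.src e → S.mul y e = y)

/-- A small category is a semigroupoid with an identity arrow at every object. -/
def IsSmallCategory (S : PreSgpd O A) : Prop :=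
  ∀ v : O, ∃ e : A, S.src e = v ∧ S.tgt e = v ∧ IsIdentity S e

/-- No object is isolated. -/
def IsolationFree (S : PreSgpd O A) : Prop :=
  ∀ v : O, ∃ a : A, S.src a = v ∨ S.tgt a = v

namespace Rees

variable {O A I Λ : Type}

/-- A triple `(i, x, λ)` is valid if `i F = x α` and `x ω = λ G`. -/
def Valid (S : Sgpd O A) (F : I → O) (G : Λ → O) (t : I × A × Λ) : Prop :=
  F t.1 = S.src t.2.1 ∧ S.tgt t.2.1 = G t.2.2

/-- The set of valid Rees triples. -/
def Triples (S : Sgpd O A) (F : I → O) (G : Λ → O) : Type :=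
  { t : I × A × Λ // Valid S F G t }

theorem prod_valid (S : Sgpd O A) {F : I → O} {G : Λ → O}
    {i : I} {x : A} {lam : Λ} {j : I} {y : A} {mu : Λ} {p : A}
    (hx : Valid S F G (i, x, lam)) (hy : Valid S F G (j, y, mu))
    (hps : S.src p = G lam) (hpt : S.tgt p = F j) :
    Valid S F G (i, S.mul (S.mul x p) y, mu) := by
  obtain ⟨hx1, hx2⟩ := hx
  obtain ⟨hy1, hy2⟩ := hy
  have h1 : S.tgt x = S.src p := by rw [hps]; exact hx2
  have h2 : S.tgt p = S.src y := by rw [hpt]; exact hy1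
  have h3 : S.tgt (S.mul x p) = S.src y := by rw [S.tgt_mul x p h1]; exact h2
  constructor
  · show F i = S.src (S.mul (S.mul x p) y)
    rw [S.src_mul _ y h3, S.src_mul x p h1]; exact hx1
  · show S.tgt (S.mul (S.mul x p) y) = G mu
    rw [S.tgt_mul _ y h3]; exact hy2

/-- Data for a Rees matrix construction with zero over a semigroupoid `S`:
indexing functions `F`, `G` surjective onto the sets of sources and of targets
respectively, and a sandwich matrix `P` with entries in `S^1 ∪ {0}`
(`none` representing `0`) compatible with `F` and `G`. -/
structure Data0 (S : Sgpd O A) (I Λ : Type) where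
  F : I → O
  G : Λ → O
  P : Λ → I → Option A
  F_into : ∀ i, ∃ a : A, S.src a = F i
  F_onto : ∀ a : A, ∃ i, F i = S.src a
  G_into : ∀ lam, ∃ a : A, S.tgt a = G lam
  G_onto : ∀ a : A, ∃ lam, G lam = S.tgt a
  P_src : ∀ lam i p, P lam i = some p → S.src p = G lam
  P_tgt : ∀ lam i p, P lam i = some p → S.tgt p = F i

/-- Underlying set of the Rees matrix semigroup with zero (`none` is the zero). -/
def Carrier0 (S : Sgpd O A) (R : Data0 S I Λ) : Type :=
  Option (Triples S R.F R.G)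

/-- Multiplication of the Rees matrix semigroup with zero. -/
def mul0 (S : Sgpd O A) (R : Data0 S I Λ) :
    Carrier0 S R → Carrier0 S R → Carrier0 S R
  | some ⟨(i, x, lam), hx⟩, some ⟨(j, y, mu), hy⟩ =>
    match hp : R.P lam j with
    | some p => some ⟨(i, S.mul (S.mul x p) y, mu),
        prod_valid S hx hy (R.P_src lam j p hp) (R.P_tgt lam j p hp)⟩
    | none => none
  | none, _ => none
  | _, none => none

/-- The Rees matrix semigroup with zero `M^0(S; F(I), G(Λ); P)`, as a
one-object semigroupoid (i.e. a semigroup). -/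
def pre0 (S : Sgpd O A) (R : Data0 S I Λ) : PreSgpd Unit (Carrier0 S R) where
  src _ := ()
  tgt _ := ()
  mul := mul0 S R

/-- Data for a Rees matrix construction without zero (no zero entries in `P`). -/
structure Data (S : Sgpd O A) (I Λ : Type) where
  F : I → O
  G : Λ → O
  P : Λ → I → A
  F_into : ∀ i, ∃ a : A, S.src a = F i
  F_onto : ∀ a : A, ∃ i, F i = S.src a
  G_into : ∀ lam, ∃ a : A, S.tgt a = G lam
  G_onto : ∀ a : A, ∃ lam, G lam = S.tgt a
  P_src : ∀ lam i, S.src (P lam i) = G lam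
  P_tgt : ∀ lam i, S.tgt (P lam i) = F i

/-- Underlying set of the Rees matrix semigroup without zero. -/
def Carrier (S : Sgpd O A) (R : Data S I Λ) : Type :=
  Triples S R.F R.G

/-- Multiplication of the Rees matrix semigroup without zero. -/
def mul (S : Sgpd O A) (R : Data S I Λ) :
    Carrier S R → Carrier S R → Carrier S R
  | ⟨(i, x, lam), hx⟩, ⟨(j, y, mu), hy⟩ =>
    ⟨(i, S.mul (S.mul x (R.P lam j)) y, mu),
      prod_valid S hx hy (R.P_src lam j) (R.P_tgt lam j)⟩

/-- The Rees matrix semigroup without zero `M(S; F(I), G(Λ); P)`, as a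
one-object semigroupoid (i.e. a semigroup). -/
def pre (S : Sgpd O A) (R : Data S I Λ) : PreSgpd Unit (Carrier S R) where
  src _ := ()
  tgt _ := ()
  mul := mul S R

/-- The set `S P' S` of arrows of the form `s p t` with `p` a non-zero entry of `P`. -/
def SPS0 (S : Sgpd O A) (R : Data0 S I Λ) : Set A :=
  { a | ∃ s p t lam i, R.P lam i = some p ∧ S.tgt s = S.src p ∧ S.tgt p = S.src t ∧
        a = S.mul (S.mul s p) t }

/-- The set `S P S` for a matrix without zero entries. -/
def SPS (S : Sgpd O A) (R : Data S I Λ) : Set A :=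
  { a | ∃ s t lam i, S.tgt s = S.src (R.P lam i) ∧ S.tgt (R.P lam i) = S.src t ∧
        a = S.mul (S.mul s (R.P lam i)) t }

/-- The set of targets of arrows of `S` (the codomain of `G`). -/
def tgtSet (S : Sgpd O A) : Set O := { v | ∃ a : A, S.tgt a = v }

/-- `T` is strongly right-ideal-generated by a row cross-section of `P`. -/
def StronglyRIG0 (S : Sgpd O A) (R : Data0 S I Λ) (T : Set A) : Prop :=
  ∃ Λ' : Set Λ, Set.BijOn R.G Λ' (tgtSet S) ∧
    ∀ t ∈ T, ∃ lam ∈ Λ', ∃ i p s, R.P lam i = some p ∧ S.tgt p = S.src s ∧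
      t = S.mul p s

/-- `T` is weakly right-ideal-generated by a row cross-section of `P`. -/
def WeaklyRIG0 (S : Sgpd O A) (R : Data0 S I Λ) (T : Set A) : Prop :=
  ∃ Λ' : Set Λ, Set.BijOn R.G Λ' (tgtSet S) ∧
    ∀ t ∈ T, ∃ lam ∈ Λ', ∃ i p, R.P lam i = some p ∧
      (t = p ∨ ∃ s, S.tgt p = S.src s ∧ t = S.mul p s)

/-- Weak right-ideal generation, for a matrix without zero entries. -/
def WeaklyRIG (S : Sgpd O A) (R : Data S I Λ) (T : Set A) : Prop :=
  ∃ Λ' : Set Λ, Set.BijOn R.G Λ' (tgtSet S) ∧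
    ∀ t ∈ T, ∃ lam ∈ Λ', ∃ i,
      (t = R.P lam i ∨ ∃ s, S.tgt (R.P lam i) = S.src s ∧ t = S.mul (R.P lam i) s)

end Rees


/-- Nondeterministic recognisability of a property of infinite sequences, with
eventually-always acceptance. -/
def Rec {α : Type} (P : (ℕ → α) → Prop) : Prop :=
  ∃ (Q : Type) (_ : Finite Q) (ini fin : Q → Prop) (T : Q → α → Q → Prop),
    ∀ x, P x ↔ ∃ q : ℕ → Q, ini (q 0) ∧ (∀ n, T (q n) (x n) (q (n + 1))) ∧
      ∃ N, ∀ n, N ≤ n → fin (q n)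

theorem Rec.congr {α : Type} {P P' : (ℕ → α) → Prop} (h : Rec P) (hh : ∀ x, P' x ↔ P x) :
    Rec P' := by
  have : P' = P := by funext x; exact propext (hh x)
  rw [this]; exact h

theorem Rec.and {α : Type} {P P' : (ℕ → α) → Prop} (h : Rec P) (h' : Rec P') :
    Rec (fun x => P x ∧ P' x) := by
  obtain ⟨Q, _, i, f, T, H⟩ := h
  obtain ⟨Q', _, i', f', T', H'⟩ := h'
  refine ⟨Q × Q', inferInstance, fun q => i q.1 ∧ i' q.2, fun q => f q.1 ∧ f' q.2,
    fun q a r => T q.1 a r.1 ∧ T' q.2 a r.2, fun x => ?_⟩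
  refine (and_congr (H x) (H' x)).trans ?_
  constructor
  · rintro ⟨⟨q, a, b, N, c⟩, ⟨q', a', b', N', c'⟩⟩
    exact ⟨fun n => (q n, q' n), ⟨a, a'⟩, fun n => ⟨b n, b' n⟩, max N N', fun n hn =>
      ⟨c n (le_trans (le_max_left _ _) hn), c' n (le_trans (le_max_right _ _) hn)⟩⟩
  · rintro ⟨q, a, b, N, c⟩
    exact ⟨⟨fun n => (q n).1, a.1, fun n => (b n).1, N, fun n hn => (c n hn).1⟩,
      ⟨fun n => (q n).2, a.2, fun n => (b n).2, N, fun n hn => (c n hn).2⟩⟩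

theorem Rec.comap {α β : Type} {P : (ℕ → β) → Prop} (h : Rec P) (g : α → β) :
    Rec (fun x : ℕ → α => P (fun n => g (x n))) := by
  obtain ⟨Q, hQ, i, f, T, H⟩ := h
  exact ⟨Q, hQ, i, f, fun q a r => T q (g a) r, fun x => H _⟩

theorem Rec.ex {α β : Type} {P : (ℕ → α × β) → Prop} (h : Rec P) :
    Rec (fun x : ℕ → α => ∃ y : ℕ → β, P (fun n => (x n, y n))) := by
  obtain ⟨Q, hQ, i, f, T, H⟩ := h
  refine ⟨Q, hQ, i, f, fun q a r => ∃ b, T q (a, b) r, fun x => ?_⟩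
  constructor
  · rintro ⟨y, hy⟩
    obtain ⟨q, a, b, c⟩ := (H _).1 hy
    exact ⟨q, a, fun n => ⟨y n, b n⟩, c⟩
  · rintro ⟨q, a, b, c⟩
    choose y hy using b
    exact ⟨y, (H _).2 ⟨q, a, hy, c⟩⟩

theorem Rec.iEx {α J : Type} [Finite J] {P : J → (ℕ → α) → Prop} (h : ∀ j, Rec (P j)) :
    Rec (fun x => ∃ j, P j x) := by
  classical
  choose Q hQ i f T H using h
  refine ⟨J × (∀ j, Option (Q j)), inferInstance, fun q => ∃ s, q.2 q.1 = some s ∧ i _ s,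
    fun q => ∃ s, q.2 q.1 = some s ∧ f _ s,
    fun q a r => ∃ s s', q.1 = r.1 ∧ q.2 q.1 = some s ∧ r.2 q.1 = some s' ∧ T _ s a s', fun x => ?_⟩
  constructor
  · rintro ⟨j, hj⟩
    obtain ⟨q, a, b, N, c⟩ := (H j x).1 hj
    refine ⟨fun n => (j, Function.update (fun _ => none) j (some (q n))), ⟨q 0, by simp, a⟩,
      fun n => ⟨q n, q (n+1), rfl, by simp, by simp, b n⟩, N, fun n hn => ⟨q n, by simp, c n hn⟩⟩
  · rintro ⟨q, ⟨s0, a0, a⟩, b, N, c⟩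
    have hc : ∀ n, (q n).1 = (q 0).1 := by
      intro n
      induction n with
      | zero => rfl
      | succ n ih =>
        obtain ⟨_, _, h1, _⟩ := b n
        rw [← h1, ih]
    generalize hj : (q 0).1 = j at *
    subst hj
    refine ⟨(q 0).1, (H _ x).2 ?_⟩
    have ht : ∀ n, ∃ s, (q n).2 (q 0).1 = some s := by
      intro n
      have hb := b n
      dsimp only at hb
      rw [hc n] at hb
      obtain ⟨s, _, _, h1, _⟩ := hb
      exact ⟨s, h1⟩
    choose r hr using ht
    refine ⟨r, ?_, ?_, N, ?_⟩
    · have := hr 0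
      rw [a0] at this
      cases this; exact a
    · intro n
      have h1 := hr n
      have h2 := hr (n+1)
      have hb := b n
      dsimp only at hb
      rw [hc n] at hb
      obtain ⟨s, s', _, h3, h4, h5⟩ := hb
      rw [h1] at h3; rw [h2] at h4
      cases h3; cases h4; exact h5
    · intro n hn
      have h1 := hr n
      have hb := c n hn
      dsimp only at hb
      rw [hc n] at hb
      obtain ⟨s, h3, h4⟩ := hb
      rw [h1] at h3; cases h3; exact h4

theorem Rec.pointwise {α : Type} (C : α → Prop) : Rec (fun x : ℕ → α => ∀ n, C (x n)) := by
  refine ⟨Unit, inferInstance, fun _ => True, fun _ => True, fun _ a _ => C a, fun x => ?_⟩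
  constructor
  · intro h; exact ⟨fun _ => (), trivial, h, 0, fun _ _ => trivial⟩
  · rintro ⟨_, _, h, _⟩; exact h

theorem Rec.loc {α : Type} [Finite α] (I : α → Prop) (C : α → α → Prop) (D : α → Prop) :
    Rec (fun x : ℕ → α => I (x 0) ∧ (∀ n, C (x n) (x (n + 1))) ∧ ∃ N, ∀ n, N ≤ n → D (x n)) := by
  refine ⟨α, inferInstance, I, D, fun q a r => q = a ∧ C q r, fun x => ?_⟩
  constructor
  · rintro ⟨a, b, c⟩; exact ⟨x, a, fun n => ⟨rfl, b n⟩, c⟩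
  · rintro ⟨q, a, b, c⟩
    have : q = x := by funext n; exact (b n).1
    subst this
    exact ⟨a, fun n => (b n).2, c⟩

/-- Sequences encoding finite lists. -/
def IsEnc {α : Type} (x : ℕ → Option α) : Prop :=
  True ∧ (∀ n, x n = none → x (n + 1) = none) ∧ ∃ N, ∀ n, N ≤ n → x n = none

theorem rec_isEnc {α : Type} [Finite α] : Rec (IsEnc (α := α)) :=
  Rec.loc (fun _ => True) (fun a b => a = none → b = none) (fun a => a = none)

theorem isEnc_list {α : Type} (l : List α) : IsEnc (fun n => l[n]?) :=
  ⟨trivial, by intro n h; simp at *; omega, l.length, by intro n h; simpa using h⟩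

theorem isEnc_exists {α : Type} {x : ℕ → Option α} (h : IsEnc x) :
    ∃ l : List α, x = fun n => l[n]? := by
  obtain ⟨-, h, N, hN⟩ := h
  induction N generalizing x with
  | zero => exact ⟨[], by funext n; simpa using hN n (Nat.zero_le _)⟩
  | succ N ih =>
    obtain ⟨l, hl⟩ := ih (x := fun n => x (n+1)) (fun n => h (n+1)) (fun n hn => hN _ (by omega))
    cases h0 : x 0 with
    | none =>
      refine ⟨[], ?_⟩
      funext n
      induction n with
      | zero => simpa using h0
      | succ n ih => simpa using h n (by simpa using ih)
    | some a =>
      refine ⟨a :: l, ?_⟩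
      funext n
      cases n with
      | zero => simpa using h0
      | succ n => simpa using congrFun hl n

theorem regular_of_rec {α : Type} {P : (ℕ → Option α) → Prop} (h : Rec P) (D : Set (List α))
    (hD : ∀ w, w ∈ D ↔ P (fun n => w[n]?)) : IsRegularSet D := by
  classical
  obtain ⟨Q, _, i, f, T, H⟩ := h
  let Acc : Set Q := {s | ∃ q : ℕ → Q, q 0 = s ∧ (∀ n, T (q n) none (q (n+1))) ∧
    ∃ N, ∀ n, N ≤ n → f (q n)}
  let M : NFA α Q := ⟨fun s a => {r | T s (some a) r}, {s | i s}, Acc⟩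
  have key : ∀ (w : List α) (S : Set Q), (∃ s ∈ Acc, s ∈ M.evalFrom S w) ↔
      ∃ q : ℕ → Q, q 0 ∈ S ∧ (∀ n, T (q n) (w[n]?) (q (n+1))) ∧ ∃ N, ∀ n, N ≤ n → f (q n) := by
    intro w
    induction w with
    | nil =>
      intro S
      constructor
      · rintro ⟨s, ⟨q, h0, h1, h2⟩, hs⟩
        exact ⟨q, by rw [h0]; simpa using hs, by simpa using h1, h2⟩
      · rintro ⟨q, h0, h1, h2⟩
        exact ⟨q 0, ⟨q, rfl, by simpa using h1, h2⟩, by simpa using h0⟩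
    | cons a w ih =>
      intro S
      rw [NFA.evalFrom_cons, ih]
      constructor
      · rintro ⟨q, h0, h1, N, h2⟩
        rw [NFA.mem_stepSet] at h0
        obtain ⟨s, hs, hs'⟩ := h0
        refine ⟨fun n => Nat.casesOn n s q, hs, ?_, N+1, ?_⟩
        · intro n
          cases n with
          | zero => exact hs'
          | succ n => simpa using h1 n
        · intro n hn
          cases n with
          | zero => omega
          | succ n => exact h2 n (by omega)
      · rintro ⟨q, h0, h1, N, h2⟩
        refine ⟨fun n => q (n+1), ?_, fun n => by simpa using h1 (n+1), N, fun n hn => h2 _ (by omega)⟩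
        rw [NFA.mem_stepSet]
        exact ⟨q 0, h0, h1 0⟩
  have e : (show Language α from D) = M.accepts := by
    ext w
    rw [NFA.mem_accepts]
    have := (hD w).trans (H _)
    refine this.trans ((key w M.start).symm.trans ?_)
    rfl
  have : Fintype Q := Fintype.ofFinite Q
  refine ⟨Set Q, inferInstance, M.toDFA, ?_⟩
  rw [NFA.toDFA_correct]; exact e.symm

theorem rec_of_regular {α : Type} {D : Set (List α)} (h : IsRegularSet D) :
    ∃ P : (ℕ → Option α) → Prop, Rec P ∧ ∀ w, P (fun n => w[n]?) ↔ w ∈ D := by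
  obtain ⟨σ, _, M, hM⟩ := h
  refine ⟨_, ⟨σ, inferInstance, fun s => s = M.start, fun s => s ∈ M.accept,
    fun s a r => r = (match a with | none => s | some a => M.step s a), fun x => Iff.rfl⟩, fun w => ?_⟩
  have hD : w ∈ D ↔ w ∈ M.accepts := by rw [hM]; rfl
  rw [hD, DFA.mem_accepts]
  have key : ∀ q : ℕ → σ, q 0 = M.start →
      (∀ n, q (n+1) = (match w[n]? with | none => q n | some a => M.step (q n) a)) →
      ∀ n, q n = M.eval (w.take n) := by
    intro q h0 h1 n
    induction n with
    | zero => simpa using h0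
    | succ n ih =>
      rw [h1, ih, List.take_add_one]
      cases w[n]? <;> simp
  constructor
  · rintro ⟨q, h0, h1, N, h2⟩
    have := key q h0 h1 (max N w.length)
    rw [List.take_of_length_le (le_max_right _ _)] at this
    rw [← this]
    exact h2 _ (le_max_left _ _)
  · intro h
    refine ⟨fun n => M.eval (w.take n), by simp, ?_, w.length, ?_⟩
    · intro n
      show M.eval (w.take (n+1)) = _
      rw [List.take_add_one]
      dsimp only
      cases w[n]? <;> simp
    · intro n hn
      dsimp only
      rw [List.take_of_length_le hn]; exact h

/-- Recognisable binary relations on lists. -/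
def LRec {α β : Type} (R : List α → List β → Prop) : Prop :=
  ∃ P : (ℕ → Option α × Option β) → Prop, Rec P ∧ ∀ u v, P (fun n => (u[n]?, v[n]?)) ↔ R u v

theorem LRec.congr {α β : Type} {R R' : List α → List β → Prop} (h : LRec R)
    (hh : ∀ u v, R' u v ↔ R u v) : LRec R' := by
  have : R' = R := by funext u v; exact propext (hh u v)
  rw [this]; exact h

theorem LRec.and {α β : Type} {R R' : List α → List β → Prop} (h : LRec R) (h' : LRec R') :
    LRec (fun u v => R u v ∧ R' u v) := by
  obtain ⟨P, a, b⟩ := h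
  obtain ⟨P', a', b'⟩ := h'
  exact ⟨_, a.and a', fun u v => and_congr (b u v) (b' u v)⟩

theorem LRec.iEx {α β J : Type} [Finite J] {R : J → List α → List β → Prop}
    (h : ∀ j, LRec (R j)) : LRec (fun u v => ∃ j, R j u v) := by
  choose P a b using h
  exact ⟨_, Rec.iEx a, fun u v => exists_congr fun j => b j u v⟩

theorem LRec.or {α β : Type} {R R' : List α → List β → Prop} (h : LRec R) (h' : LRec R') :
    LRec (fun u v => R u v ∨ R' u v) := by
  refine (LRec.iEx (J := Bool) (R := fun b => if b then R else R') ?_).congr ?_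
  · intro b; cases b <;> simpa
  · intro u v; simp [or_comm]

theorem LRec.swap {α β : Type} {R : List α → List β → Prop} (h : LRec R) :
    LRec (fun u v => R v u) := by
  obtain ⟨P, a, b⟩ := h
  exact ⟨_, a.comap Prod.swap, fun u v => b v u⟩

theorem LRec.comp {α β γ : Type} [Finite β] {R : List α → List β → Prop}
    {R' : List β → List γ → Prop} (h : LRec R) (h' : LRec R') :
    LRec (fun u w => ∃ v, R u v ∧ R' v w) := by
  obtain ⟨P, a, b⟩ := h
  obtain ⟨P', a', b'⟩ := h'
  refine ⟨_, Rec.ex (β := Option β)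
    (((rec_isEnc (α := β)).comap (α := (Option α × Option γ) × Option β) (fun t => t.2)).and
    ((a.comap (fun t => (t.1.1, t.2))).and (a'.comap (fun t => (t.2, t.1.2))))), fun u w => ?_⟩
  constructor
  · rintro ⟨y, h1, h2, h3⟩
    obtain ⟨v, hv⟩ := isEnc_exists h1
    change y = _ at hv
    subst hv
    exact ⟨v, (b _ _).1 h2, (b' _ _).1 h3⟩
  · rintro ⟨v, h2, h3⟩
    exact ⟨fun n => v[n]?, isEnc_list v, (b _ _).2 h2, (b' _ _).2 h3⟩

theorem LRec.loc {α β : Type} [Finite α] [Finite β] (I : Option α → Option β → Prop)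
    (C : Option α → Option β → Option α → Option β → Prop) :
    LRec (fun (u : List α) (v : List β) => I u[0]? v[0]? ∧ ∀ n, C u[n]? v[n]? u[n+1]? v[n+1]?) := by
  refine ⟨_, Rec.loc (fun t => I t.1 t.2) (fun s t => C s.1 s.2 t.1 t.2) (fun _ => True), ?_⟩
  intro u v
  simp

theorem LRec.regular_dom {α β : Type} [Finite β] {R : List α → List β → Prop} (h : LRec R) :
    IsRegularSet {u | ∃ v, R u v} := by
  obtain ⟨P, a, b⟩ := h
  refine regular_of_rec (Rec.ex (β := Option β)
    (((rec_isEnc (α := β)).comap (α := Option α × Option β) (fun t => t.2)).and a)) _ fun u => ?_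
  constructor
  · rintro ⟨v, h⟩
    exact ⟨fun n => v[n]?, isEnc_list v, (b _ _).2 h⟩
  · rintro ⟨y, h1, h2⟩
    obtain ⟨v, hv⟩ := isEnc_exists h1
    change y = _ at hv
    subst hv
    exact ⟨v, (b _ _).1 h2⟩

/-- Letter-by-letter coding of the convolution. -/
def cod {V E : Type} (p q : E ⊕ Option V) : Option E × Option E →
    Option ((E ⊕ Option V) × (E ⊕ Option V))
  | (none, none) => none
  | (some a, some b) => some (Sum.inl a, Sum.inl b)
  | (some a, none) => some (Sum.inl a, q)
  | (none, some b) => some (p, Sum.inl b)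

theorem delta_get {V E : Type} (etgt : E → V) (u v : List E) (n : ℕ) :
    (deltaPair etgt u v)[n]? = cod (padSym etgt u) (padSym etgt v) (u[n]?, v[n]?) := by
  unfold deltaPair
  generalize padSym etgt u = p
  generalize padSym etgt v = q
  induction n generalizing u v with
  | zero => cases u <;> cases v <;> simp [cod]
  | succ n ih =>
    cases u with
    | nil => cases v with
      | nil => simp [cod]
      | cons b v =>
        simp only [List.map_nil, List.zip_nil_left, List.nil_append, List.length_nil, Nat.zero_le,
          if_true, List.drop_zero, List.getElem?_map, List.getElem?_nil]
        cases (b :: v)[n+1]? <;> simp [cod]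
    | cons a u => cases v with
      | nil =>
        simp only [List.map_nil, List.zip_nil_right, List.nil_append, List.length_nil,
          List.length_cons, List.drop_zero, List.getElem?_nil]
        rw [if_neg (by omega)]
        simp only [List.getElem?_map]
        cases (a :: u)[n+1]? <;> simp [cod]
      | cons b v =>
        have := ih u v
        simp only [List.getElem?_cons_succ]
        rw [← this]
        simp

theorem LRec.sync {V E : Type} [Finite E] (etgt : E → V) {R : Set (List E × List E)}
    (h : LRec (fun u v => (u, v) ∈ R)) (p q : E ⊕ Option V)
    (hR : ∀ u v, (u, v) ∈ R → padSym etgt u = p ∧ padSym etgt v = q) : SyncRegular etgt R := by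
  obtain ⟨P, a, b⟩ := h
  refine regular_of_rec (Rec.ex (β := Option E × Option E)
    (((rec_isEnc (α := E)).comap (α := Option ((E ⊕ Option V) × (E ⊕ Option V)) ×
      (Option E × Option E)) (fun t => t.2.1)).and
    (((rec_isEnc (α := E)).comap (fun t => t.2.2)).and
    ((a.comap (fun t => t.2)).and (Rec.pointwise (fun t => t.1 = cod p q t.2)))))) _ fun w => ?_
  constructor
  · rintro ⟨⟨u, v⟩, h, rfl⟩
    refine ⟨fun n => (u[n]?, v[n]?), isEnc_list u, isEnc_list v, (b _ _).2 h, fun n => ?_⟩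
    obtain ⟨h1, h2⟩ := hR u v h
    subst h1 h2
    exact delta_get etgt u v n
  · rintro ⟨y, h1, h2, h3, h4⟩
    obtain ⟨u, hu⟩ := isEnc_exists h1
    obtain ⟨v, hv⟩ := isEnc_exists h2
    have hy : y = fun n => (u[n]?, v[n]?) := by
      funext n; exact Prod.ext (congrFun hu n) (congrFun hv n)
    subst hy
    have hm := (b u v).1 h3
    refine ⟨(u, v), hm, ?_⟩
    obtain ⟨h1, h2⟩ := hR u v hm
    subst h1 h2
    apply List.ext_getElem?
    intro n
    rw [delta_get]
    exact h4 n

theorem sync_lrec {E : Type} (etgt : E → Unit) {R : Set (List E × List E)}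
    (h : SyncRegular etgt R) (hR : ∀ u v, (u, v) ∈ R → u ≠ [] ∧ v ≠ []) [Finite E] :
    LRec (fun u v => (u, v) ∈ R) := by
  obtain ⟨P, a, b⟩ := rec_of_regular h
  have hne : LRec (fun u v : List E => u ≠ [] ∧ v ≠ []) := by
    refine (LRec.loc (α := E) (β := E) (fun a b => a ≠ none ∧ b ≠ none)
      (fun _ _ _ _ => True)).congr ?_
    intro u v
    cases u <;> cases v <;> simp
  let p : E ⊕ Option Unit := Sum.inr (some ())
  have hpad : ∀ u : List E, u ≠ [] → padSym etgt u = p := by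
    intro u hu
    unfold padSym
    rw [List.getLast?_eq_getLast_of_ne_nil hu]
    rfl
  have hinj : Function.Injective (cod p p) := by
    rintro ⟨a, b⟩ ⟨c, d⟩ h
    cases a <;> cases b <;> cases c <;> cases d <;> simp_all [cod, p]
  obtain ⟨P', a', b'⟩ := hne
  refine ⟨_, (a.comap (cod p p)).and a', fun u v => ?_⟩
  refine (and_congr_right' (b' u v)).trans ?_
  have hd : ∀ u v : List E, u ≠ [] → v ≠ [] →
      (fun n : ℕ => cod p p (u[n]?, v[n]?)) = fun n : ℕ => (deltaPair etgt u v)[n]? := by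
    intro u v hu hv
    funext n
    rw [delta_get, hpad u hu, hpad v hv]
  constructor
  · rintro ⟨h1, hu, hv⟩
    rw [hd u v hu hv, b] at h1
    obtain ⟨⟨u', v'⟩, hm, he⟩ := h1
    obtain ⟨hu', hv'⟩ := hR _ _ hm
    have h3 : ∀ n : ℕ, (u[n]?, v[n]?) = (u'[n]?, v'[n]?) := by
      intro n
      apply hinj
      have h4 := congrFun (hd u v hu hv) n
      have h5 := congrFun (hd u' v' hu' hv') n
      dsimp only at h4 h5 he
      rw [h4, h5, he]
    have h6 : u = u' := List.ext_getElem? fun n => congrArg Prod.fst (h3 n)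
    have h7 : v = v' := List.ext_getElem? fun n => congrArg Prod.snd (h3 n)
    rw [h6, h7]; exact hm
  · intro hm
    obtain ⟨hu, hv⟩ := hR _ _ hm
    refine ⟨?_, hu, hv⟩
    rw [hd u v hu hv, b]
    exact ⟨(u, v), hm, rfl⟩

/-- Action of a semigroup-with-formal-identity element. -/
def act {O A : Type} (S : PreSgpd O A) : Option A → A → A
  | none, t => t
  | some m, t => S.mul m t

theorem eval_snoc {O A E : Type} (S : PreSgpd O A) (lab : E → A) (l : List E) (e : E) :
    evalPath? S lab (l ++ [e]) = some (act S (evalPath? S lab l) (lab e)) := by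
  cases l <;> simp [evalPath?, act]

theorem eval_ne_nil {O A E : Type} (S : PreSgpd O A) (lab : E → A) (l : List E) (h : l ≠ []) :
    ∃ t, evalPath? S lab l = some t := by
  cases l with
  | nil => exact absurd rfl h
  | cons a l => exact ⟨_, rfl⟩

theorem lrec_snoc {X : Type} [Finite X] (x : X) :
    LRec (fun k w : List X => w = k ++ [x]) := by
  refine (LRec.loc (α := X) (β := X) (fun a b => b = (if a = none then some x else a))
    (fun a _ a' b' => b' = (if a = none then none else if a' = none then some x else a'))).congr ?_
  intro k w
  have key : ∀ n : ℕ, (k ++ [x])[n+1]? =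
      (if k[n]? = none then none else if k[n+1]? = none then some x else k[n+1]?) := by
    intro n
    rcases lt_trichotomy (n+1) k.length with h | h | h
    · simp [h, show n < k.length by omega]
    · simp [h, show n < k.length by omega]
    · have h1 : k[n]? = none := by simp; omega
      rw [h1]; simp; omega
  have key0 : (k ++ [x])[0]? = (if k[0]? = none then some x else k[0]?) := by
    cases k <;> simp
  constructor
  · rintro rfl
    exact ⟨key0, key⟩
  · rintro ⟨h0, h1⟩
    apply List.ext_getElem?
    intro n
    cases n with
    | zero => rw [h0, key0]
    | succ n => rw [h1, key]

theorem lrec_nil_single {X : Type} [Finite X] (l : List X) :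
    LRec (fun k w : List X => k = [] ∧ w = l) := by
  induction l using List.reverseRecOn with
  | nil =>
    refine (LRec.loc (α := X) (β := X) (fun a b => a = none ∧ b = none)
      (fun _ _ _ _ => True)).congr ?_
    intro u v
    cases u <;> cases v <;> simp
  | append_singleton l x ih =>
    refine (ih.comp (lrec_snoc x)).congr ?_
    intro u v
    constructor
    · rintro ⟨rfl, rfl⟩; exact ⟨l, ⟨rfl, rfl⟩, rfl⟩
    · rintro ⟨_, ⟨rfl, rfl⟩, rfl⟩; exact ⟨rfl, rfl⟩

/-- Words of `K` together with the empty word. -/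
def K1 {O B X : Type} {N : PreSgpd O B} (C : ChoiceOfReps N X) (k : List X) : Prop :=
  k = [] ∨ k ∈ C.K

theorem pathTgt_unit {X : Type} (g : X → Unit) (l : List X) (h : l ≠ []) (o : Unit) :
    pathTgt? g l = some o := by
  unfold pathTgt?
  rw [List.getLast?_eq_getLast_of_ne_nil h]; rfl

theorem lrec_B_letter {B X : Type} {N : PreSgpd Unit B} (C : ChoiceOfReps N X)
    (hC : IsAutomaticStructure C) (x : X) :
    LRec (fun k w : List X => K1 C k ∧ w ∈ C.K ∧
      some (act N (evalPath? N C.lab k) (C.lab x)) = evalPath? N C.lab w) := by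
  obtain ⟨hX, -, hE, hV⟩ := hC
  have h1 := sync_lrec C.etgt (hE x) (fun u v h => ⟨(C.K_path _ h.1).1, (C.K_path _ h.2.1).1⟩)
  have h2 := sync_lrec C.etgt (hV ()) (fun u v h => ⟨(C.K_path _ h.1).1, (C.K_path _ h.2.1).1⟩)
  obtain ⟨k0, hk0, hk0'⟩ := C.K_onto (C.lab x)
  refine (h1.or ((lrec_nil_single k0).comp h2)).congr ?_
  intro k w
  constructor
  · rintro ⟨rfl | hk, hw, h⟩
    · right
      exact ⟨k0, ⟨rfl, rfl⟩, hk0, hw, pathTgt_unit _ _ (C.K_path _ hk0).1 _, hk0'.trans h⟩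
    · left
      exact ⟨hk, hw, pathTgt_unit _ _ (C.K_path _ hk).1 _, (eval_snoc _ _ _ _).trans h⟩
  · rintro (⟨hk, hw, -, h⟩ | ⟨_, ⟨rfl, rfl⟩, hk, hw, -, h⟩)
    · exact ⟨Or.inr hk, hw, (eval_snoc _ _ _ _).symm.trans h⟩
    · exact ⟨Or.inl rfl, hw, hk0'.symm.trans h⟩

theorem lrec_B {B X : Type} {N : PreSgpd Unit B} (C : ChoiceOfReps N X)
    (hC : IsAutomaticStructure C)
    (hassoc : ∀ a b c, N.mul (N.mul a b) c = N.mul a (N.mul b c)) (t : B) :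
    LRec (fun k w : List X => K1 C k ∧ w ∈ C.K ∧
      some (act N (evalPath? N C.lab k) t) = evalPath? N C.lab w) := by
  obtain ⟨z, -, hz⟩ := C.K_onto t
  induction z using List.reverseRecOn generalizing t with
  | nil => simp [evalPath?] at hz
  | append_singleton z x ih =>
    rw [eval_snoc] at hz
    rcases eq_or_ne z [] with rfl | hne
    · have : t = C.lab x := by simpa [evalPath?, act] using hz.symm
      rw [this]
      exact lrec_B_letter C hC x
    · obtain ⟨t', ht'⟩ := eval_ne_nil N C.lab z hne
      rw [ht'] at hz
      have ht : t = N.mul t' (C.lab x) := by simpa [act] using hz.symm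
      have hX := hC.1
      refine ((ih t' ht').comp (lrec_B_letter C hC x)).congr ?_
      have hact : ∀ o, act N o t = N.mul (act N o t') (C.lab x) := by
        intro o
        cases o with
        | none => exact ht
        | some m => rw [ht]; exact (hassoc _ _ _).symm
      intro k w
      constructor
      · rintro ⟨hk, hw, h⟩
        obtain ⟨v, hv, hv'⟩ := C.K_onto (act N (evalPath? N C.lab k) t')
        refine ⟨v, ⟨hk, hv, hv'.symm⟩, Or.inr hv, hw, ?_⟩
        rw [hv', ← h, hact]; rfl
      · rintro ⟨v, ⟨hk, hv, hv'⟩, -, hw, h⟩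
        refine ⟨hk, hw, ?_⟩
        rw [← h, ← hv', hact]; rfl

theorem lrec_Q {B X : Type} {N : PreSgpd Unit B} (C : ChoiceOfReps N X)
    (hC : IsAutomaticStructure C)
    (hassoc : ∀ a b c, N.mul (N.mul a b) c = N.mul a (N.mul b c)) (t t' : B) :
    LRec (fun k k' : List X => K1 C k ∧ K1 C k' ∧
      act N (evalPath? N C.lab k) t = act N (evalPath? N C.lab k') t') := by
  have hX := hC.1
  refine ((lrec_B C hC hassoc t).comp (lrec_B C hC hassoc t').swap).congr ?_
  intro k k'
  constructor
  · rintro ⟨hk, hk', h⟩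
    obtain ⟨v, hv, hv'⟩ := C.K_onto (act N (evalPath? N C.lab k) t)
    exact ⟨v, ⟨hk, hv, hv'.symm⟩, hk', hv, by rw [hv', h]⟩
  · rintro ⟨v, ⟨hk, hv, hv'⟩, hk', -, h⟩
    exact ⟨hk, hk', Option.some.inj (hv'.trans h.symm)⟩

section ReesPart

open Rees

variable {O A I Λ : Type} {S : Sgpd O A} {D : Data0 S I Λ}

/-- The zero of the Rees matrix semigroup. -/
def zr : Carrier0 S D := (none : Option (Triples S D.F D.G))

/-- The inclusion of the non-zero elements. -/
def nz (t : Triples S D.F D.G) : Carrier0 S D := (some t : Option (Triples S D.F D.G))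

theorem nz_inj {t r : Triples S D.F D.G} (h : nz t = nz r) : t = r := Option.some.inj h

theorem nz_ne {t : Triples S D.F D.G} (h : nz t = zr) : False := by
  cases (show (some t : Option (Triples S D.F D.G)) = none from h)

theorem carrier_cases (a : Carrier0 S D) : a = zr ∨ ∃ t, a = nz t :=
  match a with
  | none => Or.inl rfl
  | some t => Or.inr ⟨t, rfl⟩

/-- First component. -/
def tI (t : Triples S D.F D.G) : I := t.1.1
/-- Middle component. -/
def tS (t : Triples S D.F D.G) : A := t.1.2.1
/-- Last component. -/
def tL (t : Triples S D.F D.G) : Λ := t.1.2.2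

theorem tF (t : Triples S D.F D.G) : D.F (tI t) = S.src (tS t) := t.2.1
theorem tG (t : Triples S D.F D.G) : S.tgt (tS t) = D.G (tL t) := t.2.2

/-- Constructor for triples. -/
def tmk (i : I) (s : A) (l : Λ) (h1 : D.F i = S.src s) (h2 : S.tgt s = D.G l) :
    Triples S D.F D.G := ⟨(i, s, l), h1, h2⟩

theorem t_ext {t r : Triples S D.F D.G} (h1 : tI t = tI r) (h2 : tS t = tS r) (h3 : tL t = tL r) :
    t = r := Subtype.ext (Prod.ext h1 (Prod.ext h2 h3))

theorem mul0_some (t r : Triples S D.F D.G) (p : A) (hp : D.P (tL t) (tI r) = some p) :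
    ∃ q, mul0 S D (nz t) (nz r) = nz q ∧ tI q = tI t ∧ tS q = S.mul (S.mul (tS t) p) (tS r) ∧
      tL q = tL r := by
  obtain ⟨⟨i, x, lam⟩, hx⟩ := t
  obtain ⟨⟨j, y, mu⟩, hy⟩ := r
  change D.P lam j = some p at hp
  refine ⟨⟨(i, S.mul (S.mul x p) y, mu),
    prod_valid S hx hy (D.P_src lam j p hp) (D.P_tgt lam j p hp)⟩, ?_, rfl, rfl, rfl⟩
  show (match hp : D.P lam j with
    | some p => (some ⟨(i, S.mul (S.mul x p) y, mu),
        prod_valid S hx hy (D.P_src lam j p hp) (D.P_tgt lam j p hp)⟩ :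
          Option (Triples S D.F D.G))
    | none => none) = some _
  split
  · rename_i p' hp'
    have : p' = p := Option.some.inj (hp'.symm.trans hp)
    subst this; rfl
  · rename_i hp'
    rw [hp] at hp'; cases hp'

theorem mul0_zero (t r : Triples S D.F D.G)
    (hp : D.P (tL t) (tI r) = none) : mul0 S D (nz t) (nz r) = zr := by
  obtain ⟨⟨i, x, lam⟩, hx⟩ := t
  obtain ⟨⟨j, y, mu⟩, hy⟩ := r
  change D.P lam j = none at hp
  show (match hp : D.P lam j with
    | some p => (some ⟨(i, S.mul (S.mul x p) y, mu),
        prod_valid S hx hy (D.P_src lam j p hp) (D.P_tgt lam j p hp)⟩ :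
          Option (Triples S D.F D.G))
    | none => none) = none
  split
  · rename_i p' hp'
    rw [hp] at hp'; cases hp'
  · rfl

theorem mul0_zr_left (r : Carrier0 S D) : mul0 S D zr r = zr := by
  rcases carrier_cases r with rfl | ⟨t, rfl⟩ <;> rfl

theorem mul0_zr_right (r : Carrier0 S D) : mul0 S D r zr = zr := by
  rcases carrier_cases r with rfl | ⟨t, rfl⟩ <;> rfl

/-- Inversion for non-zero products. -/
theorem mul0_eq_nz (a b : Carrier0 S D)
    (t : Triples S D.F D.G) (h : mul0 S D a b = nz t) :
    ∃ r s p, a = nz r ∧ b = nz s ∧ D.P (tL r) (tI s) = some p ∧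
      tI t = tI r ∧ tS t = S.mul (S.mul (tS r) p) (tS s) ∧ tL t = tL s := by
  rcases carrier_cases a with rfl | ⟨r, rfl⟩
  · rw [mul0_zr_left] at h; exact (nz_ne h.symm).elim
  rcases carrier_cases b with rfl | ⟨s, rfl⟩
  · rw [mul0_zr_right] at h; exact (nz_ne h.symm).elim
  cases hp : D.P (tL r) (tI s) with
  | none => rw [mul0_zero r s hp] at h; exact (nz_ne h.symm).elim
  | some p =>
    obtain ⟨q, he, h1, h2, h3⟩ := mul0_some r s p hp
    rw [he] at h
    cases nz_inj h
    exact ⟨r, s, p, rfl, rfl, hp, h1, h2, h3⟩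

theorem P_comp_left {l : Λ} {i : I} {p : A} (hp : D.P l i = some p) (t : Triples S D.F D.G)
    (h : tL t = l) : S.tgt (tS t) = S.src p := by
  rw [tG, D.P_src _ _ _ hp, h]

theorem P_comp_right {l : Λ} {i : I} {p : A} (hp : D.P l i = some p) (t : Triples S D.F D.G)
    (h : tI t = i) : S.tgt p = S.src (tS t) := by
  rw [← tF, D.P_tgt _ _ _ hp, h]

theorem mul0_assoc (a b c : Carrier0 S D) :
    mul0 S D (mul0 S D a b) c = mul0 S D a (mul0 S D b c) := by
  rcases carrier_cases a with rfl | ⟨r, rfl⟩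
  · simp only [mul0_zr_left]
  rcases carrier_cases b with rfl | ⟨s, rfl⟩
  · simp only [mul0_zr_left, mul0_zr_right]
  rcases carrier_cases c with rfl | ⟨t, rfl⟩
  · simp only [mul0_zr_right]
  cases hp : D.P (tL r) (tI s) with
  | none =>
    rw [mul0_zero r s hp, mul0_zr_left]
    cases hq : D.P (tL s) (tI t) with
    | none => rw [mul0_zero s t hq, mul0_zr_right]
    | some q =>
      obtain ⟨x, e1, h1, h2, h3⟩ := mul0_some s t q hq
      rw [e1, mul0_zero r x (by rw [h1]; exact hp)]
  | some p =>
    obtain ⟨x, e1, h1, h2, h3⟩ := mul0_some r s p hp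
    rw [e1]
    cases hq : D.P (tL s) (tI t) with
    | none =>
      rw [mul0_zero s t hq, mul0_zr_right, mul0_zero x t (by rw [h3]; exact hq)]
    | some q =>
      obtain ⟨y, e2, h1', h2', h3'⟩ := mul0_some s t q hq
      obtain ⟨z, e3, h1z, h2z, h3z⟩ := mul0_some x t q (by rw [h3]; exact hq)
      obtain ⟨w, e4, h1w, h2w, h3w⟩ := mul0_some r y p (by rw [h1']; exact hp)
      rw [e2, e3, e4]
      have a1 : S.tgt (tS r) = S.src p := P_comp_left hp r rfl
      have a2 : S.tgt p = S.src (tS s) := P_comp_right hp s rfl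
      have a3 : S.tgt (tS s) = S.src q := P_comp_left hq s rfl
      have a4 : S.tgt q = S.src (tS t) := P_comp_right hq t rfl
      have a5 : S.tgt (S.mul (tS r) p) = S.src (tS s) := by rw [S.tgt_mul _ _ a1, a2]
      have a6 : S.tgt (S.mul (tS s) q) = S.src (tS t) := by rw [S.tgt_mul _ _ a3, a4]
      have a7 : S.tgt (S.mul (tS r) p) = S.src (S.mul (tS s) q) := by rw [a5, S.src_mul _ _ a3]
      congr 1
      apply t_ext
      · rw [h1z, h1, h1w]
      · rw [h2z, h2, h2w, h2', S.mul_assoc' _ _ _ a5 a3, S.mul_assoc' _ _ _ a7 a6]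
      · rw [h3z, h3w, h3']

end ReesPart

section Construction

open Rees

variable {O A I Λ X : Type} {S : Sgpd O A} {D : Data0 S I Λ}

/-- The label relation for the new edges: an edge is a letter together with (optionally) the
letter preceding it. -/
def EL (C : ChoiceOfReps (pre0 S D) X) (o : Option X × X) (a : A) : Prop :=
  ∃ t : Triples S D.F D.G, C.lab o.2 = nz t ∧ ((o.1 = none ∧ a = tS t) ∨
    ∃ y, o.1 = some y ∧ ∃ (r : Triples S D.F D.G) (p : A), C.lab y = nz r ∧
      D.P (tL r) (tI t) = some p ∧ a = S.mul p (tS t))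

/-- The new edges. -/
def NE (C : ChoiceOfReps (pre0 S D) X) : Type := {o : Option X × X // ∃ a, EL C o a}

/-- The letter of an edge. -/
def cur {C : ChoiceOfReps (pre0 S D) X} (e : NE C) : X := e.1.2
/-- The preceding letter of an edge. -/
def prv {C : ChoiceOfReps (pre0 S D) X} (e : NE C) : Option X := e.1.1
/-- The label of an edge. -/
noncomputable def nlab {C : ChoiceOfReps (pre0 S D) X} (e : NE C) : A := e.2.choose

theorem nlab_spec {C : ChoiceOfReps (pre0 S D) X} (e : NE C) :
    ∃ t : Triples S D.F D.G, C.lab (cur e) = nz t ∧ ((prv e = none ∧ nlab e = tS t) ∨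
    ∃ y, prv e = some y ∧ ∃ (r : Triples S D.F D.G) (p : A), C.lab y = nz r ∧
      D.P (tL r) (tI t) = some p ∧ nlab e = S.mul p (tS t)) := e.2.choose_spec

/-- Coherence of a list of edges. -/
def Coh {C : ChoiceOfReps (pre0 S D) X} (u : List (NE C)) : Prop :=
  (∀ e, u[0]? = some e → prv e = none) ∧
  ∀ (n : ℕ) (e e' : NE C), u[n]? = some e → u[n+1]? = some e' → prv e' = some (cur e)

theorem coh_snoc {C : ChoiceOfReps (pre0 S D) X} (u : List (NE C)) (e : NE C) :
    Coh (u ++ [e]) ↔ Coh u ∧ prv e = u.getLast?.map cur := by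
  rcases List.eq_nil_or_concat u with rfl | ⟨l, b, rfl⟩
  · simp [Coh]
  · rw [List.concat_eq_append]
    simp only [List.getLast?_append, List.getLast?_singleton, Option.some_or, Option.map_some]
    constructor
    · rintro ⟨h0, h1⟩
      refine ⟨⟨?_, ?_⟩, ?_⟩
      · intro e' he'
        apply h0
        rw [List.getElem?_append_left (by simp)]; exact he'
      · intro n e1 e2 h2 h3
        have hn : n + 1 < (l ++ [b]).length := by
          by_contra hc
          rw [List.getElem?_eq_none (by omega)] at h3; cases h3
        apply h1 n
        · rw [List.getElem?_append_left (by omega)]; exact h2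
        · rw [List.getElem?_append_left hn]; exact h3
      · apply h1 l.length
        · simp
        · simp
    · rintro ⟨⟨h0, h1⟩, h2⟩
      refine ⟨?_, ?_⟩
      · intro e' he'
        apply h0
        rw [List.getElem?_append_left (by simp)] at he'; exact he'
      · intro n e1 e2 h3 h4
        rcases lt_trichotomy (n + 1) (l ++ [b]).length with hn | hn | hn
        · rw [List.getElem?_append_left (by omega)] at h3
          rw [List.getElem?_append_left hn] at h4
          exact h1 n _ _ h3 h4
        · have hn' : n = l.length := by simpa using hn
          subst hn'
          have e1b : b = e1 := by simpa using h3
          have e2b : e = e2 := by simpa using h4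
          rw [← e1b, ← e2b]; exact h2
        · rw [List.getElem?_eq_none (by simp at hn ⊢; omega)] at h4; cases h4

theorem coh_eval {C : ChoiceOfReps (pre0 S D) X} (u : List (NE C)) (hu : Coh u) (hne : u ≠ []) :
    ∃ t : Triples S D.F D.G, evalPath? (pre0 S D) C.lab (u.map cur) = some (nz t) ∧
      evalPath? S.toPreSgpd nlab u = some (tS t) ∧
      IsPathChain (fun e => S.src (nlab e)) (fun e => S.tgt (nlab e)) u ∧
      (∃ (e : NE C) (r : Triples S D.F D.G), u[0]? = some e ∧ C.lab (cur e) = nz r ∧ tI t = tI r) ∧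
      (∃ (e : NE C) (r : Triples S D.F D.G), u.getLast? = some e ∧ C.lab (cur e) = nz r ∧
        tL t = tL r ∧ S.tgt (nlab e) = S.tgt (tS r)) := by
  induction u using List.reverseRecOn with
  | nil => exact absurd rfl hne
  | append_singleton u e ih =>
    obtain ⟨hc, hp⟩ := (coh_snoc u e).1 hu
    obtain ⟨t, ht, hcase⟩ := nlab_spec e
    rcases eq_or_ne u [] with rfl | hne'
    · rcases hcase with ⟨-, h1⟩ | ⟨y, h1, -⟩
      · refine ⟨t, ?_, ?_, ?_, ⟨e, t, by simp, ht, rfl⟩, ⟨e, t, by simp, ht, rfl, by rw [h1]⟩⟩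
        · simp [evalPath?, ht]
        · simp [evalPath?, h1]
        · exact List.isChain_singleton _
      · rw [h1] at hp; simp at hp
    · obtain ⟨t', h1, h2, h3, ⟨e0, r0, h4, h5, h6⟩, ⟨e1, r1, h7, h8, h9, h10⟩⟩ := ih hc hne'
      rw [h7] at hp
      rcases hcase with ⟨h11, -⟩ | ⟨y, h11, r, p, h12, h13, h14⟩
      · rw [h11] at hp; simp at hp
      rw [h11] at hp
      have hy : y = cur e1 := by simpa using hp
      subst hy
      have hr : r = r1 := nz_inj (h12.symm.trans h8)
      subst hr
      rw [← h9] at h13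
      obtain ⟨q, e2, h1q, h2q, h3q⟩ := mul0_some t' t p h13
      have a1 : S.tgt (tS t') = S.src p := P_comp_left h13 t' rfl
      have a2 : S.tgt p = S.src (tS t) := P_comp_right h13 t rfl
      refine ⟨q, ?_, ?_, ?_, ⟨e0, r0, ?_, h5, by rw [h1q, h6]⟩, ⟨e, t, by simp, ht, h3q, ?_⟩⟩
      · rw [List.map_append, List.map_singleton, eval_snoc, h1, ht]
        exact congrArg some e2
      · rw [eval_snoc, h2, h14, h2q, S.mul_assoc' _ _ _ a1 a2]; rfl
      · refine List.isChain_append.2 ⟨h3, List.isChain_singleton _, ?_⟩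
        intro x hx z hz
        have hx' : x = e1 := by rw [h7] at hx; simpa using hx.symm
        have hz' : z = e := by simpa using hz.symm
        rw [hx', hz']
        dsimp only
        rw [h10, h14, S.src_mul _ _ a2, ← a1, tG, tG, h9]
      · rw [List.getElem?_append_left (List.length_pos_iff.2 hne')]; exact h4
      · rw [h14, S.tgt_mul _ _ a2]

theorem coh_exists (C : ChoiceOfReps (pre0 S D) X) (w : List X) (t : Triples S D.F D.G)
    (h : evalPath? (pre0 S D) C.lab w = some (nz t)) :
    ∃ u : List (NE C), Coh u ∧ u.map cur = w := by
  induction w using List.reverseRecOn generalizing t with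
  | nil => simp [evalPath?] at h
  | append_singleton w x ih =>
    rw [eval_snoc] at h
    have h := Option.some.inj h
    rcases eq_or_ne w [] with rfl | hne
    · change C.lab x = nz t at h
      let e : NE C := ⟨(none, x), tS t, t, h, Or.inl ⟨rfl, rfl⟩⟩
      exact ⟨[e], (coh_snoc [] e).2 ⟨by simp [Coh], rfl⟩, rfl⟩
    · obtain ⟨m, hm⟩ := eval_ne_nil (pre0 S D) C.lab w hne
      rw [hm] at h
      change mul0 S D m (C.lab x) = nz t at h
      obtain ⟨r, s, p, rfl, h2, h3, -⟩ := mul0_eq_nz _ _ _ h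
      obtain ⟨u, hu, hw⟩ := ih r hm
      have hune : u ≠ [] := by rintro rfl; exact hne hw.symm
      obtain ⟨t', h1, -, -, -, ⟨e1, r1, h7, h8, h9, -⟩⟩ := coh_eval u hu hune
      rw [hw, hm] at h1
      have : r = t' := nz_inj (Option.some.inj h1)
      subst this
      let e : NE C := ⟨(some (cur e1), x), S.mul p (tS s), s, h2,
        Or.inr ⟨cur e1, rfl, r1, p, h8, by rw [← h9]; exact h3, rfl⟩⟩
      refine ⟨u ++ [e], (coh_snoc u e).2 ⟨hu, by rw [h7]; rfl⟩, ?_⟩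
      rw [List.map_append, hw]; rfl

/-- First-letter condition. -/
def FirstOK (σ : O → I) {C : ChoiceOfReps (pre0 S D) X} (u : List (NE C)) : Prop :=
  ∀ e, u[0]? = some e → ∀ t, C.lab (cur e) = nz t → tI t = σ (D.F (tI t))

/-- Last-letter condition. -/
def LastOK (τ : O → Λ) {C : ChoiceOfReps (pre0 S D) X} (u : List (NE C)) : Prop :=
  ∀ (n : ℕ) e, u[n]? = some e → u[n+1]? = none → ∀ t, C.lab (cur e) = nz t → tL t = τ (D.G (tL t))

/-- The relation between new paths and words of `K` (possibly empty) obtained by deleting the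
last letter. -/
def RX (σ : O → I) (τ : O → Λ) {C : ChoiceOfReps (pre0 S D) X} (x : X) (u : List (NE C))
    (k : List X) : Prop :=
  Coh u ∧ FirstOK σ u ∧ LastOK τ u ∧ u.map cur = k ++ [x]

theorem lrec_RX [Finite X] (σ : O → I) (τ : O → Λ) (C : ChoiceOfReps (pre0 S D) X) (x : X) :
    LRec (RX σ τ (C := C) x) := by
  have : Finite (NE C) := by unfold NE; infer_instance
  have h1 : LRec (fun (u : List (NE C)) (_ : List X) => Coh u) := by
    refine (LRec.loc (α := NE C) (β := X) (fun a _ => ∀ e, a = some e → prv e = none)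
      (fun a _ a' _ => ∀ e e', a = some e → a' = some e' → prv e' = some (cur e))).congr ?_
    intro u v; rfl
  have h2 : LRec (fun (u : List (NE C)) (_ : List X) => FirstOK σ u) := by
    refine (LRec.loc (α := NE C) (β := X)
      (fun a _ => ∀ e, a = some e → ∀ t, C.lab (cur e) = nz t → tI t = σ (D.F (tI t)))
      (fun a _ a' _ => True)).congr ?_
    intro u v; simp [FirstOK]
  have h3 : LRec (fun (u : List (NE C)) (_ : List X) => LastOK τ u) := by
    refine (LRec.loc (α := NE C) (β := X)
      (fun a _ => True)
      (fun a _ a' _ => ∀ e, a = some e → a' = none → ∀ t, C.lab (cur e) = nz t →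
        tL t = τ (D.G (tL t)))).congr ?_
    intro u v; simp [LastOK]
  have h4 : LRec (fun (u : List (NE C)) (w : List X) => u.map cur = w) := by
    refine (LRec.loc (α := NE C) (β := X) (fun a b => a.map cur = b)
      (fun _ _ a' b' => a'.map cur = b')).congr ?_
    intro u v
    constructor
    · rintro rfl; simp
    · rintro ⟨h0, h1⟩
      apply List.ext_getElem?
      intro n
      cases n with
      | zero => simpa using h0
      | succ n => simpa using h1 n
  refine (h1.and (h2.and (h3.and (h4.comp (lrec_snoc x).swap)))).congr ?_
  intro u k
  simp [RX]

/-- Normalised triples. -/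
def Norm (σ : O → I) (τ : O → Λ) (t : Triples S D.F D.G) : Prop :=
  tI t = σ (S.src (tS t)) ∧ tL t = τ (S.tgt (tS t))

theorem norm_ext {σ : O → I} {τ : O → Λ} {t r : Triples S D.F D.G} (ht : Norm σ τ t)
    (hr : Norm σ τ r) (h : tS t = tS r) : t = r :=
  t_ext (by rw [ht.1, hr.1, h]) h (by rw [ht.2, hr.2, h])

theorem RX_eval {σ : O → I} {τ : O → Λ} {C : ChoiceOfReps (pre0 S D) X} {x : X}
    {u : List (NE C)} {k : List X} (h : RX σ τ x u k) :
    ∃ t r : Triples S D.F D.G, act (pre0 S D) (evalPath? (pre0 S D) C.lab k) (C.lab x) = nz t ∧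
      evalPath? S.toPreSgpd nlab u = some (tS t) ∧ u ≠ [] ∧
      IsPathChain (fun e => S.src (nlab e)) (fun e => S.tgt (nlab e)) u ∧
      Norm σ τ t ∧ C.lab x = nz r ∧ S.tgt (tS r) = S.tgt (tS t) ∧
      pathTgt? (fun e => S.tgt (nlab e)) u = some (S.tgt (tS t)) := by
  obtain ⟨h1, h2, h3, h4⟩ := h
  have hne : u ≠ [] := by rintro rfl; simp at h4
  obtain ⟨t, a1, a2, a3, ⟨e0, r0, a4, a5, a6⟩, ⟨e1, r1, a7, a8, a9, a10⟩⟩ := coh_eval u h1 hne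
  rw [h4, eval_snoc] at a1
  have hx : cur e1 = x := by
    have := congrArg List.getLast? h4
    rw [List.getLast?_map, a7] at this
    simpa using this
  have htg : S.tgt (tS r1) = S.tgt (tS t) := by rw [tG, tG, a9]
  refine ⟨t, r1, Option.some.inj a1, a2, hne, a3, ⟨?_, ?_⟩, by rw [← hx]; exact a8, htg, ?_⟩
  · have := h2 e0 a4 r0 a5
    rw [a6, this, ← a6, tF]
  · rw [List.getLast?_eq_getElem?] at a7
    have hpos := List.length_pos_iff.2 hne
    have := h3 _ e1 a7 (by rw [List.getElem?_eq_none]; omega) r1 a8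
    rw [a9, this, ← a9, tG]
  · unfold pathTgt?
    rw [a7, ← htg, ← a10]; rfl

theorem RX_exists {σ : O → I} {τ : O → Λ} {C : ChoiceOfReps (pre0 S D) X} {x : X} {k : List X}
    {t : Triples S D.F D.G}
    (h : act (pre0 S D) (evalPath? (pre0 S D) C.lab k) (C.lab x) = nz t) (ht : Norm σ τ t) :
    ∃ u : List (NE C), RX σ τ x u k ∧ evalPath? S.toPreSgpd nlab u = some (tS t) := by
  have hh : evalPath? (pre0 S D) C.lab (k ++ [x]) = some (nz t) := by rw [eval_snoc, h]
  obtain ⟨u, hu, hm⟩ := coh_exists C _ t hh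
  have hne : u ≠ [] := by rintro rfl; simp at hm
  obtain ⟨t', a1, a2, a3, ⟨e0, r0, a4, a5, a6⟩, ⟨e1, r1, a7, a8, a9, a10⟩⟩ := coh_eval u hu hne
  rw [hm, hh] at a1
  have := nz_inj (Option.some.inj a1)
  subst this
  refine ⟨u, ⟨hu, ?_, ?_, hm⟩, a2⟩
  · intro e he r hr
    rw [a4] at he
    cases he
    have : r = r0 := nz_inj (hr.symm.trans a5)
    subst this
    rw [← a6, tF]; exact ht.1
  · intro n e he hn r hr
    rw [List.getLast?_eq_getElem?] at a7
    have hn' : n = u.length - 1 := by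
      have := List.getElem?_eq_none_iff.1 hn
      have h2 : n < u.length := by
        by_contra hc
        rw [List.getElem?_eq_none (by omega)] at he; cases he
      omega
    rw [hn', a7] at he
    cases he
    have : r = r1 := nz_inj (hr.symm.trans a8)
    subst this
    rw [← a9, ← tG]; exact ht.2

/-- The automatic structure for `S`. -/
noncomputable def newChoice (σ : O → I) (τ : O → Λ)
    (hσ : ∀ a : A, D.F (σ (S.src a)) = S.src a) (hτ : ∀ a : A, D.G (τ (S.tgt a)) = S.tgt a)
    (C : ChoiceOfReps (pre0 S D) X) : ChoiceOfReps S.toPreSgpd (NE C) where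
  esrc e := S.src (nlab e)
  etgt e := S.tgt (nlab e)
  lab := nlab
  lab_src _ := rfl
  lab_tgt _ := rfl
  K := {u | ∃ x k, RX σ τ x u k ∧ K1 C k}
  K_path := by
    rintro u ⟨x, k, h, -⟩
    obtain ⟨t, r, -, -, h1, h2, -⟩ := RX_eval h
    exact ⟨h1, h2⟩
  K_onto := by
    intro a
    let t : Triples S D.F D.G := tmk (σ (S.src a)) a (τ (S.tgt a)) (hσ a) (hτ a).symm
    have ht : Norm σ τ t := ⟨rfl, rfl⟩
    obtain ⟨w, hw, hw'⟩ := C.K_onto (nz t)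
    rcases List.eq_nil_or_concat w with rfl | ⟨l, x, rfl⟩
    · simp [evalPath?] at hw'
    · rw [List.concat_eq_append, eval_snoc] at hw'
      have hk : ∃ k, K1 C k ∧ evalPath? (pre0 S D) C.lab k = evalPath? (pre0 S D) C.lab l := by
        rcases eq_or_ne l [] with rfl | hl
        · exact ⟨[], Or.inl rfl, rfl⟩
        · obtain ⟨m, hm⟩ := eval_ne_nil (pre0 S D) C.lab l hl
          obtain ⟨k, hk, hk'⟩ := C.K_onto m
          exact ⟨k, Or.inr hk, hk'.trans hm.symm⟩
      obtain ⟨k, hk, hk'⟩ := hk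
      rw [← hk'] at hw'
      obtain ⟨u, hu, hu'⟩ := RX_exists (Option.some.inj hw') ht
      exact ⟨u, ⟨x, k, hu, hk⟩, hu'⟩

/-- The generic relation on new paths. -/
def RelT (σ : O → I) (τ : O → Λ) (C : ChoiceOfReps (pre0 S D) X) (T : X → Carrier0 S D)
    (Y : X → Prop) (u v : List (NE C)) : Prop :=
  ∃ j : {p : X × X // Y p.1}, ∃ k, RX σ τ j.1.1 u k ∧ ∃ k', (K1 C k ∧ K1 C k' ∧
    act (pre0 S D) (evalPath? (pre0 S D) C.lab k) (T j.1.1) =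
      act (pre0 S D) (evalPath? (pre0 S D) C.lab k') (C.lab j.1.2)) ∧ RX σ τ j.1.2 v k'

theorem lrec_RelT (σ : O → I) (τ : O → Λ) (C : ChoiceOfReps (pre0 S D) X)
    (hC : IsAutomaticStructure C) (T : X → Carrier0 S D) (Y : X → Prop) :
    LRec (RelT σ τ C T Y) := by
  have hX := hC.1
  refine LRec.iEx fun j => (lrec_RX σ τ C j.1.1).comp
    ((lrec_Q C hC mul0_assoc (T j.1.1) (C.lab j.1.2)).comp (lrec_RX σ τ C j.1.2).swap)

/-- Multiplying the last factor on the right by an arrow. -/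
theorem act_mul (o : Option (Carrier0 S D)) (r t : Triples S D.F D.G) (a : A)
    (h : act (pre0 S D) o (nz r) = nz t) (ha : S.tgt (tS r) = S.src a)
    (q : Triples S D.F D.G) (h1 : tI q = tI r) (h2 : tS q = S.mul (tS r) a) :
    ∃ s, act (pre0 S D) o (nz q) = nz s ∧ tI s = tI t ∧ tS s = S.mul (tS t) a ∧ tL s = tL q := by
  cases o with
  | none =>
    have : r = t := nz_inj h
    subst this
    exact ⟨q, rfl, h1, h2, rfl⟩
  | some m =>
    change mul0 S D m (nz r) = nz t at h
    obtain ⟨m', r', p, rfl, hr, hp, e1, e2, e3⟩ := mul0_eq_nz _ _ _ h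
    have : r = r' := nz_inj hr
    subst this
    obtain ⟨s, g0, g1, g2, g3⟩ := mul0_some m' q p (by rw [h1]; exact hp)
    have a1 : S.tgt (tS m') = S.src p := P_comp_left hp m' rfl
    have a2 : S.tgt p = S.src (tS r) := P_comp_right hp r rfl
    refine ⟨s, g0, by rw [g1, e1], ?_, g3⟩
    rw [g2, h2, e2, S.mul_assoc' _ _ _ _ ha]
    rw [S.tgt_mul _ _ a1, a2]

theorem newChoice_automatic (σ : O → I) (τ : O → Λ)
    (hσ : ∀ a : A, D.F (σ (S.src a)) = S.src a) (hτ : ∀ a : A, D.G (τ (S.tgt a)) = S.tgt a)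
    (C : ChoiceOfReps (pre0 S D) X) (hC : IsAutomaticStructure C) :
    IsAutomaticStructure (newChoice σ τ hσ hτ C) := by
  classical
  have hX := hC.1
  have hN : Finite (NE C) := by unfold NE; infer_instance
  have pad : ∀ (u : List (NE C)) (o : O), pathTgt? (newChoice σ τ hσ hτ C).etgt u = some o →
      padSym (newChoice σ τ hσ hτ C).etgt u = Sum.inr (some o) := by
    intro u o h; exact congrArg Sum.inr h
  refine ⟨hN, ?_, ?_, ?_⟩
  · have := (lrec_RelT σ τ C hC C.lab (fun _ => True)).regular_dom
    convert this using 1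
    ext u
    constructor
    · rintro ⟨x, k, h1, h2⟩
      exact ⟨u, ⟨(x, x), trivial⟩, k, h1, k, ⟨h2, h2, rfl⟩, h1⟩
    · rintro ⟨v, j, k, h1, k', ⟨h2, -⟩, -⟩
      exact ⟨_, k, h1, h2⟩
  · intro a
    let Y : X → Prop := fun x => ∃ r : Triples S D.F D.G, C.lab x = nz r ∧
      S.tgt (tS r) = S.src (nlab a)
    have hT : ∀ x, ∃ c : Carrier0 S D, ∀ r : Triples S D.F D.G, C.lab x = nz r →
        S.tgt (tS r) = S.src (nlab a) → ∃ q, c = nz q ∧ tI q = tI r ∧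
          tS q = S.mul (tS r) (nlab a) ∧ tL q = τ (S.tgt (nlab a)) := by
      intro x
      by_cases hx : Y x
      · obtain ⟨r, hr, hr'⟩ := hx
        refine ⟨nz (tmk (tI r) (S.mul (tS r) (nlab a)) (τ (S.tgt (nlab a)))
          (by rw [S.src_mul _ _ hr', tF]) (by rw [S.tgt_mul _ _ hr', hτ])), ?_⟩
        intro r' hr2 _
        have : r = r' := nz_inj (hr.symm.trans hr2)
        subst this
        exact ⟨_, rfl, rfl, rfl, rfl⟩
      · exact ⟨zr, fun r h1 h2 => (hx ⟨r, h1, h2⟩).elim⟩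
    choose T hT using hT
    -- the key computation
    have key : ∀ x u k x' v k', RX σ τ (C := C) x u k → RX σ τ (C := C) x' v k' → Y x →
        ((evalPath? S.toPreSgpd nlab (u ++ [a]) = evalPath? S.toPreSgpd nlab v) ↔
        act (pre0 S D) (evalPath? (pre0 S D) C.lab k) (T x) =
          act (pre0 S D) (evalPath? (pre0 S D) C.lab k') (C.lab x')) := by
      rintro x u k x' v k' hu hv ⟨r, hr, hr'⟩
      obtain ⟨t, r1, b1, b2, -, -, b3, b4, b5, -⟩ := RX_eval hu
      obtain ⟨t', r2, c1, c2, -, -, c3, c4, c5, -⟩ := RX_eval hv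
      have : r = r1 := nz_inj (hr.symm.trans b4)
      subst this
      obtain ⟨q, d0, d1, d2, d3⟩ := hT x r hr hr'
      rw [hr] at b1
      obtain ⟨s, f0, f1, f2, f3⟩ := act_mul _ r t (nlab a) b1 hr' q d1 d2
      have hta : S.tgt (tS t) = S.src (nlab a) := by rw [← b5, hr']
      have hs : Norm σ τ s := by
        refine ⟨?_, ?_⟩
        · rw [f1, b3.1, f2, S.src_mul _ _ hta]
        · rw [f3, d3, f2, S.tgt_mul _ _ hta]
      rw [d0, f0, c1, eval_snoc, b2, c2]
      constructor
      · intro h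
        rw [norm_ext hs c3]
        rw [f2]; exact Option.some.inj h
      · intro h
        rw [← nz_inj h, f2]; rfl
    have hL := lrec_RelT σ τ C hC T Y
    refine LRec.sync _ (R := relEdge (newChoice σ τ hσ hτ C) a) (hL.congr ?_)
      (Sum.inr (some (S.src (nlab a)))) (Sum.inr (some (S.tgt (nlab a)))) ?_
    · intro u v
      constructor
      · rintro ⟨⟨x, k, hu, hk⟩, ⟨x', k', hv, hk'⟩, htg, he⟩
        obtain ⟨t, r1, b1, b2, -, -, b3, b4, b5, b6⟩ := RX_eval hu
        have hY : Y x := ⟨r1, b4, by rw [b5]; exact Option.some.inj (b6.symm.trans htg)⟩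
        exact ⟨⟨(x, x'), hY⟩, k, hu, k', ⟨hk, hk', (key _ _ _ _ _ _ hu hv hY).1 he⟩, hv⟩
      · rintro ⟨⟨⟨x, x'⟩, hY⟩, k, hu, k', ⟨hk, hk', h⟩, hv⟩
        refine ⟨⟨x, k, hu, hk⟩, ⟨x', k', hv, hk'⟩, ?_, (key _ _ _ _ _ _ hu hv hY).2 h⟩
        obtain ⟨t, r1, b1, b2, -, -, b3, b4, b5, b6⟩ := RX_eval hu
        obtain ⟨r, hr, hr'⟩ := hY
        have : r = r1 := nz_inj (hr.symm.trans b4)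
        subst this
        refine b6.trans ?_
        rw [← b5, hr']; rfl
    · rintro u v ⟨⟨x, k, hu, hk⟩, ⟨x', k', hv, hk'⟩, htg, he⟩
      refine ⟨pad u _ htg, pad v _ ?_⟩
      obtain ⟨t, r1, b1, b2, -, -, b3, b4, b5, b6⟩ := RX_eval hu
      obtain ⟨t', r2, c1, c2, -, -, c3, c4, c5, c6⟩ := RX_eval hv
      refine c6.trans ?_
      change evalPath? S.toPreSgpd nlab (u ++ [a]) = evalPath? S.toPreSgpd nlab v at he
      rw [eval_snoc, b2, c2] at he
      have ht : S.tgt (tS t) = S.src (nlab a) := Option.some.inj (b6.symm.trans htg)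
      rw [← Option.some.inj he]
      exact congrArg some (S.tgt_mul _ _ ht)
  · intro o
    let Y : X → Prop := fun x => ∃ r : Triples S D.F D.G, C.lab x = nz r ∧ S.tgt (tS r) = o
    have key : ∀ x u k x' v k', RX σ τ (C := C) x u k → RX σ τ (C := C) x' v k' →
        ((evalPath? S.toPreSgpd nlab u = evalPath? S.toPreSgpd nlab v) ↔
        act (pre0 S D) (evalPath? (pre0 S D) C.lab k) (C.lab x) =
          act (pre0 S D) (evalPath? (pre0 S D) C.lab k') (C.lab x')) := by
      rintro x u k x' v k' hu hv
      obtain ⟨t, r1, b1, b2, -, -, b3, b4, b5, -⟩ := RX_eval hu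
      obtain ⟨t', r2, c1, c2, -, -, c3, c4, c5, -⟩ := RX_eval hv
      rw [b1, c1, b2, c2]
      constructor
      · intro h
        rw [norm_ext b3 c3 (Option.some.inj h)]
      · intro h
        rw [nz_inj h]
    have hL := lrec_RelT σ τ C hC C.lab Y
    refine LRec.sync _ (R := relVertex (newChoice σ τ hσ hτ C) o) (hL.congr ?_)
      (Sum.inr (some o)) (Sum.inr (some o)) ?_
    · intro u v
      constructor
      · rintro ⟨⟨x, k, hu, hk⟩, ⟨x', k', hv, hk'⟩, htg, he⟩
        obtain ⟨t, r1, b1, b2, -, -, b3, b4, b5, b6⟩ := RX_eval hu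
        have hY : Y x := ⟨r1, b4, by rw [b5]; exact Option.some.inj (b6.symm.trans htg)⟩
        exact ⟨⟨(x, x'), hY⟩, k, hu, k', ⟨hk, hk', (key _ _ _ _ _ _ hu hv).1 he⟩, hv⟩
      · rintro ⟨⟨⟨x, x'⟩, hY⟩, k, hu, k', ⟨hk, hk', h⟩, hv⟩
        refine ⟨⟨x, k, hu, hk⟩, ⟨x', k', hv, hk'⟩, ?_, (key _ _ _ _ _ _ hu hv).2 h⟩
        obtain ⟨t, r1, b1, b2, -, -, b3, b4, b5, b6⟩ := RX_eval hu
        obtain ⟨r, hr, hr'⟩ := hY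
        have : r = r1 := nz_inj (hr.symm.trans b4)
        subst this
        refine b6.trans ?_
        rw [← b5, hr']
    · rintro u v ⟨⟨x, k, hu, hk⟩, ⟨x', k', hv, hk'⟩, htg, he⟩
      refine ⟨pad u _ htg, pad v _ ?_⟩
      obtain ⟨t, r1, b1, b2, -, -, b3, b4, b5, b6⟩ := RX_eval hu
      obtain ⟨t', r2, c1, c2, -, -, c3, c4, c5, c6⟩ := RX_eval hv
      refine c6.trans ?_
      change evalPath? S.toPreSgpd nlab u = evalPath? S.toPreSgpd nlab v at he
      rw [b2, c2] at he
      rw [← Option.some.inj he]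
      exact b6.symm.trans htg

end Construction

/-- Theorem 4.7: if a Rees matrix semigroup with zero is automatic and the
non-identity arrows of `S` are weakly right-ideal-generated by a row
cross-section of `P`, then `S` is automatic. -/
theorem stmt_11 {O A I Λ : Type} (S : Sgpd O A) (hne : Nonempty A)
    (hiso : IsolationFree S.toPreSgpd)
    (R : Rees.Data0 S I Λ)
    (hM : IsAutomatic (Rees.pre0 S R))
    (hrig : Rees.WeaklyRIG0 S R { a : A | ¬ IsIdentity S.toPreSgpd a }) :
    IsAutomatic S.toPreSgpd := by
  obtain ⟨X, C, hC⟩ := hM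
  obtain ⟨a⟩ := hne
  have hI : Nonempty I := ⟨(R.F_onto a).choose⟩
  have hL : Nonempty Λ := ⟨(R.G_onto a).choose⟩
  exact ⟨_, _, newChoice_automatic (Function.invFun R.F) (Function.invFun R.G)
    (fun a => Function.invFun_eq (R.F_onto a)) (fun a => Function.invFun_eq (R.G_onto a)) C hC⟩

end AutoRees
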